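/- Let j ∈ ℤ, A ≥ 0, f ∈ E_A, l ∈ ℕ and m > lA. Then the l-th iterate of the operator S_{m,j} satisfies S_{m,j}^l f = S_{m/l, j} f on [0,∞). -/

import Mathlib

open MeasureTheory Real Filter Asymptotics

/-- The basis functions `s_{n,k}(x) = (nx)^k / k! · e^{-nx}` for `k ≥ 0`, and `0` for `k < 0`. -/
noncomputable def szk (n : ℝ) (k : ℤ) (x : ℝ) : ℝ :=
  if k < 0 then 0 else (n * x) ^ k.toNat / (Nat.factorial k.toNat) * Real.exp (-n * x)

/-- Membership in `E_A`: locally integrable on `[0,∞)` and `|f t| ≤ K e^{A t}` for some `K > 0`. -/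
def MemEA (A : ℝ) (f : ℝ → ℝ) : Prop :=
  LocallyIntegrableOn f (Set.Ici 0) volume ∧ ∃ K > 0, ∀ t ≥ (0:ℝ), |f t| ≤ K * Real.exp (A * t)

/-- The Szász-Mirakjan-Durrmeyer type operator `S_{n,j}`. -/
noncomputable def Snj (n : ℝ) (j : ℤ) (f : ℝ → ℝ) (x : ℝ) : ℝ :=
  f 0 * ∑ k ∈ Finset.range j.toNat, szk n k x
    + ∑' k : ℕ, szk n (max 0 j + k) x *
        (n * ∫ t in Set.Ioi (0:ℝ), szk n (max 0 j + k - j) t * f t)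

lemma szk_natCast (n : ℝ) (k : ℕ) (x : ℝ) :
    szk n (k : ℤ) x = (n * x) ^ k / (Nat.factorial k) * Real.exp (-n * x) := by
  simp [szk]

lemma szk_natCast_nonneg {n x : ℝ} (hn : 0 ≤ n) (hx : 0 ≤ x) (k : ℕ) : 0 ≤ szk n (k : ℤ) x := by
  rw [szk_natCast]
  positivity

lemma continuous_szk_natCast (n : ℝ) (k : ℕ) : Continuous (szk n (k : ℤ)) := by
  simp_rw [funext (szk_natCast n k)]
  fun_prop

lemma hasSum_szk_natCast (n x : ℝ) : HasSum (fun k : ℕ => szk n (k : ℤ) x) 1 := by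
  have h := (NormedSpace.expSeries_div_hasSum_exp (𝔸 := ℝ) (n * x)).mul_right (Real.exp (-n * x))
  rw [← Real.exp_eq_exp_ℝ, ← Real.exp_add] at h
  simp_rw [szk_natCast]
  simpa using h

lemma lintegral_szk {c : ℝ} (hc : 0 < c) (k : ℕ) :
    ∫⁻ t in Set.Ioi (0 : ℝ), ENNReal.ofReal (szk c (k : ℤ) t) = ENNReal.ofReal (1 / c) := by
  have hG := Real.integral_rpow_mul_exp_neg_mul_Ioi (a := k + 1) (r := c) (by positivity) hc
  have hval : ∫ t in Set.Ioi (0 : ℝ), szk c (k : ℤ) t = 1 / c := by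
    have : ∀ t : ℝ, szk c (k : ℤ) t
        = c ^ k / (Nat.factorial k) * (t ^ ((k + 1 : ℝ) - 1) * Real.exp (-(c * t))) := by
      intro t
      rw [szk_natCast, add_sub_cancel_right, Real.rpow_natCast, mul_pow, neg_mul]
      ring
    simp_rw [this]
    rw [integral_const_mul, hG, Real.Gamma_nat_eq_factorial]
    rw [show (k + 1 : ℝ) = ((k + 1 : ℕ) : ℝ) by push_cast; ring, Real.rpow_natCast, one_div_pow, pow_succ]
    have := Nat.factorial_ne_zero k
    field_simp
  rw [← hval, ofReal_integral_eq_lintegral_ofReal]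
  · by_contra h
    rw [integral_undef h] at hval
    have : 0 < 1 / c := by positivity
    linarith
  · filter_upwards [ae_restrict_mem measurableSet_Ioi] with t ht
    exact szk_natCast_nonneg hc.le (le_of_lt ht) k

lemma szk_mul_szk {m n : ℝ} (hmn : m + n ≠ 0) (a b : ℕ) (u : ℝ) :
    szk m (a : ℤ) u * szk n (b : ℤ) u
      = (Nat.choose (a + b) a) * m ^ a * n ^ b / (m + n) ^ (a + b)
        * szk (m + n) ((a + b : ℕ) : ℤ) u := by
  simp_rw [szk_natCast]
  rw [Nat.cast_add_choose, show -(m + n) * u = -m * u + -n * u by ring, Real.exp_add]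
  have h1 := Nat.factorial_ne_zero a
  have h2 := Nat.factorial_ne_zero b
  have h3 := Nat.factorial_ne_zero (a + b)
  simp only [mul_pow]
  field_simp
  ring

lemma lintegral_szk_mul_szk {m n : ℝ} (hm : 0 < m) (hn : 0 < n) (a b : ℕ) :
    ∫⁻ u in Set.Ioi (0 : ℝ), ENNReal.ofReal (szk m (a : ℤ) u) * ENNReal.ofReal (szk n (b : ℤ) u)
      = ENNReal.ofReal
          ((Nat.choose (a + b) a) * m ^ a * n ^ b / (m + n) ^ (a + b + 1)) := by
  have hmn : 0 < m + n := by positivity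
  have : ∀ u ∈ Set.Ioi (0 : ℝ),
      ENNReal.ofReal (szk m (a : ℤ) u) * ENNReal.ofReal (szk n (b : ℤ) u)
      = ENNReal.ofReal ((Nat.choose (a + b) a) * m ^ a * n ^ b / (m + n) ^ (a + b))
        * ENNReal.ofReal (szk (m + n) ((a + b : ℕ) : ℤ) u) := by
    intro u hu
    rw [← ENNReal.ofReal_mul (szk_natCast_nonneg hm.le (le_of_lt hu) a),
      szk_mul_szk hmn.ne', ENNReal.ofReal_mul (by positivity)]
  rw [setLIntegral_congr_fun measurableSet_Ioi this,
    lintegral_const_mul' _ _ ENNReal.ofReal_ne_top, lintegral_szk hmn,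
    ← ENNReal.ofReal_mul (by positivity)]
  congr 1
  rw [pow_succ]
  field_simp

/-- A form of Vandermonde's identity. -/
lemma sum_inv_factorial_vandermonde_aux (q k i : ℕ) :
    ∑ r ∈ Finset.range (min k i + 1),
      (1 : ℝ) / ((Nat.factorial r) * (Nat.factorial (r + q))
        * (Nat.factorial (k - r)) * (Nat.factorial (i - r)))
    = (Nat.factorial (k + i + q)) / ((Nat.factorial k) * (Nat.factorial (i + q))
        * (Nat.factorial (k + q)) * (Nat.factorial i)) := by
  have hv := Nat.add_choose_eq k (i + q) i
  rw [Finset.Nat.sum_antidiagonal_eq_sum_range_succ_mk] at hv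
  have hsub : ∑ r ∈ Finset.range (min k i + 1), k.choose r * (i + q).choose (i - r)
      = (k + (i + q)).choose i := by
    rw [hv]
    apply Finset.sum_subset
    · intro r; simp only [Finset.mem_range]; omega
    · intro r h1 h2
      simp only [Finset.mem_range] at h1 h2
      rw [Nat.choose_eq_zero_of_lt (by omega), zero_mul]
  have hR : ((k + (i + q)).choose i : ℝ)
      = (Nat.factorial (k + i + q)) / ((Nat.factorial i) * (Nat.factorial (k + q))) := by
    rw [show k + (i + q) = i + (k + q) by ring, Nat.cast_add_choose]
    congr 3; ring
  have h1 : ∀ a, (Nat.factorial a : ℝ) ≠ 0 := fun a => by exact_mod_cast Nat.factorial_ne_zero a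
  have : (Nat.factorial (k + i + q) : ℝ) / ((Nat.factorial k) * (Nat.factorial (i + q))
        * (Nat.factorial (k + q)) * (Nat.factorial i))
      = ((k + (i + q)).choose i : ℝ) / ((Nat.factorial k) * (Nat.factorial (i + q))) := by
    rw [hR]
    field_simp [h1]
  rw [this, ← hsub]
  push_cast
  rw [Finset.sum_div]
  refine Finset.sum_congr rfl fun r hr => ?_
  simp only [Finset.mem_range] at hr
  rw [Nat.cast_choose ℝ (show r ≤ k by omega), Nat.cast_choose ℝ (show i - r ≤ i + q by omega),
    show i + q - (i - r) = r + q by omega]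
  have := h1 k
  have := h1 (i + q)
  field_simp

lemma sum_inv_factorial_vandermonde {p q : ℕ} (hpq : p = 0 ∨ q = 0) (k i : ℕ) :
    ∑ r ∈ Finset.range (min k i + 1),
      (1 : ℝ) / ((Nat.factorial (r + p)) * (Nat.factorial (r + q))
        * (Nat.factorial (k - r)) * (Nat.factorial (i - r)))
    = (Nat.factorial (k + q + (i + p))) / ((Nat.factorial (k + p)) * (Nat.factorial (i + q))
        * (Nat.factorial (k + q)) * (Nat.factorial (i + p))) := by
  rcases hpq with rfl | rfl
  · have := sum_inv_factorial_vandermonde_aux q k i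
    rw [show k + q + (i + 0) = k + i + q by ring]
    simpa using this
  · have := sum_inv_factorial_vandermonde_aux p i k
    rw [min_comm, show i + k + p = k + 0 + (i + p) by ring] at this
    convert this using 1
    · refine Finset.sum_congr rfl fun r _ => ?_
      simp only [add_zero]; ring
    · simp only [add_zero]; ring

lemma ofReal_szk_eq_tsum {N n t : ℝ} (hN : 0 ≤ N) (hNn : N ≤ n) (ht : 0 ≤ t) (k : ℕ) :
    ENNReal.ofReal (szk N (k : ℤ) t) = ∑' h : ℕ, ENNReal.ofReal
      ((N * t) ^ k / (Nat.factorial k) * (((n - N) * t) ^ h / (Nat.factorial h))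
        * Real.exp (-n * t)) := by
  have h := ((NormedSpace.expSeries_div_hasSum_exp (𝔸 := ℝ) ((n - N) * t)).mul_left
    ((N * t) ^ k / (Nat.factorial k))).mul_right (Real.exp (-n * t))
  rw [← Real.exp_eq_exp_ℝ, mul_assoc, ← Real.exp_add,
    show (n - N) * t + -n * t = -N * t by ring, ← szk_natCast] at h
  have h0 : 0 ≤ n - N := by linarith
  rw [← h.tsum_eq, ENNReal.ofReal_tsum_of_nonneg (fun _ => by positivity) h.summable]

lemma tsum_ite_le_sub (r : ℕ) (G : ℕ → ENNReal) :
    ∑' k : ℕ, (if r ≤ k then G (k - r) else 0) = ∑' h : ℕ, G h := by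
  have hinj : Function.Injective (fun h : ℕ => h + r) := add_left_injective r
  rw [← hinj.tsum_eq]
  · simp
  · intro k hk
    have : r ≤ k := by
      by_contra hc
      simp [hc] at hk
    exact ⟨k - r, by simp [this]⟩

lemma szk_kernel_coeff {p q : ℕ} (hpq : p = 0 ∨ q = 0) {m n N : ℝ} (hm : 0 < m) (hn : 0 < n)
    (hN : N = m * n / (m + n)) (x t : ℝ) (k i : ℕ) :
    szk m ((k + p : ℕ) : ℤ) x * m * (n * szk n ((i + q : ℕ) : ℤ) t) *
      ((Nat.choose (k + q + (i + p)) (k + q)) * m ^ (k + q) * n ^ (i + p)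
        / (m + n) ^ (k + q + (i + p) + 1))
    = ∑ r ∈ Finset.range (min k i + 1),
      N * ((N * x) ^ (r + p) / (Nat.factorial (r + p))
          * (((m - N) * x) ^ (k - r) / (Nat.factorial (k - r))) * Real.exp (-m * x))
        * ((N * t) ^ (r + q) / (Nat.factorial (r + q))
          * (((n - N) * t) ^ (i - r) / (Nat.factorial (i - r))) * Real.exp (-n * t)) := by
  have hmn : 0 < m + n := by positivity
  have h1 : ∀ a, (Nat.factorial a : ℝ) ≠ 0 := fun a => by exact_mod_cast Nat.factorial_ne_zero a
  have hmN : m - N = m ^ 2 / (m + n) := by rw [hN]; field_simp; ring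
  have hnN : n - N = n ^ 2 / (m + n) := by rw [hN]; field_simp; ring
  set C : ℝ := m ^ (2 * k + p + q + 1) * n ^ (2 * i + p + q + 1) / (m + n) ^ (k + i + p + q + 1)
    * x ^ (k + p) * t ^ (i + q) * Real.exp (-m * x) * Real.exp (-n * t) with hC
  have hterm : ∀ r ∈ Finset.range (min k i + 1),
      N * ((N * x) ^ (r + p) / (Nat.factorial (r + p))
          * (((m - N) * x) ^ (k - r) / (Nat.factorial (k - r))) * Real.exp (-m * x))
        * ((N * t) ^ (r + q) / (Nat.factorial (r + q))
          * (((n - N) * t) ^ (i - r) / (Nat.factorial (i - r))) * Real.exp (-n * t))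
      = C * (1 / ((Nat.factorial (r + p)) * (Nat.factorial (r + q))
        * (Nat.factorial (k - r)) * (Nat.factorial (i - r)))) := by
    intro r hr
    simp only [Finset.mem_range] at hr
    obtain ⟨a, rfl⟩ := Nat.exists_eq_add_of_le (show r ≤ k by omega)
    obtain ⟨b, rfl⟩ := Nat.exists_eq_add_of_le (show r ≤ i by omega)
    rw [hmN, hnN, hC, hN, Nat.add_sub_cancel_left, Nat.add_sub_cancel_left]
    have := h1 (r + p)
    have := h1 (r + q)
    have := h1 a
    have := h1 b
    simp only [mul_pow, div_pow]
    field_simp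
    ring
  rw [Finset.sum_congr rfl hterm, ← Finset.mul_sum, sum_inv_factorial_vandermonde hpq,
    Nat.cast_add_choose, szk_natCast, szk_natCast, hC]
  have := h1 (k + p)
  have := h1 (k + q)
  have := h1 (i + p)
  have := h1 (i + q)
  simp only [mul_pow]
  field_simp
  ring

lemma tsum_tsum_szk_kernel {p q : ℕ} (hpq : p = 0 ∨ q = 0) {m n N : ℝ} (hm : 0 < m) (hn : 0 < n)
    (hN : N = m * n / (m + n)) {x t : ℝ} (hx : 0 ≤ x) (ht : 0 ≤ t) :
    ∑' k : ℕ, ∑' i : ℕ, ENNReal.ofReal (szk m ((k + p : ℕ) : ℤ) x * m *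
        (n * szk n ((i + q : ℕ) : ℤ) t) *
      ((Nat.choose (k + q + (i + p)) (k + q)) * m ^ (k + q) * n ^ (i + p)
        / (m + n) ^ (k + q + (i + p) + 1)))
    = ∑' r : ℕ, ENNReal.ofReal N * ENNReal.ofReal (szk N ((r + p : ℕ) : ℤ) x)
        * ENNReal.ofReal (szk N ((r + q : ℕ) : ℤ) t) := by
  have hN0 : 0 ≤ N := by rw [hN]; positivity
  have hNm : N ≤ m := by
    rw [hN, div_le_iff₀ (by positivity)]; nlinarith [mul_pos hm hm]
  have hNn : N ≤ n := by
    rw [hN, div_le_iff₀ (by positivity)]; nlinarith [mul_pos hn hn]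
  have hm0 : 0 ≤ m - N := by linarith
  have hn0 : 0 ≤ n - N := by linarith
  set a : ℕ → ℕ → ℝ := fun r h => (N * x) ^ (r + p) / (Nat.factorial (r + p))
    * (((m - N) * x) ^ h / (Nat.factorial h)) * Real.exp (-m * x) with ha
  set b : ℕ → ℕ → ℝ := fun r h => (N * t) ^ (r + q) / (Nat.factorial (r + q))
    * (((n - N) * t) ^ h / (Nat.factorial h)) * Real.exp (-n * t) with hb
  have ha0 : ∀ r h, 0 ≤ a r h := fun r h => by simp only [ha]; positivity
  have hb0 : ∀ r h, 0 ≤ b r h := fun r h => by simp only [hb]; positivity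
  have hentry : ∀ k i : ℕ, ENNReal.ofReal (szk m ((k + p : ℕ) : ℤ) x * m *
        (n * szk n ((i + q : ℕ) : ℤ) t) *
      ((Nat.choose (k + q + (i + p)) (k + q)) * m ^ (k + q) * n ^ (i + p)
        / (m + n) ^ (k + q + (i + p) + 1)))
      = ∑' r : ℕ, if r ≤ k then (if r ≤ i then
          ENNReal.ofReal N * ENNReal.ofReal (a r (k - r)) * ENNReal.ofReal (b r (i - r))
          else 0) else 0 := by
    intro k i
    rw [szk_kernel_coeff hpq hm hn hN, ENNReal.ofReal_sum_of_nonneg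
      (fun r _ => mul_nonneg (mul_nonneg hN0 (ha0 r (k - r))) (hb0 r (i - r))),
      tsum_eq_sum (s := Finset.range (min k i + 1))]
    · refine Finset.sum_congr rfl fun r hr => ?_
      simp only [Finset.mem_range] at hr
      rw [if_pos (by omega), if_pos (by omega),
        ENNReal.ofReal_mul (mul_nonneg hN0 (ha0 r (k - r))), ENNReal.ofReal_mul hN0]
    · intro r hr
      simp only [Finset.mem_range] at hr
      split_ifs <;> first | rfl | omega
  simp_rw [hentry]
  have h1 : ∀ k : ℕ, (∑' i : ℕ, ∑' r : ℕ, if r ≤ k then (if r ≤ i then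
          ENNReal.ofReal N * ENNReal.ofReal (a r (k - r)) * ENNReal.ofReal (b r (i - r))
          else 0) else 0)
      = ∑' r : ℕ, if r ≤ k then
          ENNReal.ofReal N * ENNReal.ofReal (a r (k - r)) * ∑' h, ENNReal.ofReal (b r h)
          else 0 := by
    intro k
    rw [ENNReal.tsum_comm]
    refine tsum_congr fun r => ?_
    split_ifs
    · rw [tsum_ite_le_sub r fun h =>
        ENNReal.ofReal N * ENNReal.ofReal (a r (k - r)) * ENNReal.ofReal (b r h),
        ENNReal.tsum_mul_left]
    · simp
  simp_rw [h1]
  rw [ENNReal.tsum_comm]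
  refine tsum_congr fun r => ?_
  rw [tsum_ite_le_sub r fun h =>
    ENNReal.ofReal N * ENNReal.ofReal (a r h) * ∑' h, ENNReal.ofReal (b r h),
    ENNReal.tsum_mul_right, ENNReal.tsum_mul_left, ofReal_szk_eq_tsum hN0 hNm hx,
    ofReal_szk_eq_tsum hN0 hNn ht]

/-- The operator `φ ↦ ∑ k, s_{n,k+p} · n ∫ s_{n,k+q} φ` on `[0,∞]`-valued functions. -/
noncomputable def durrmeyerLIntegral (n : ℝ) (p q : ℕ) (φ : ℝ → ENNReal) (x : ℝ) : ENNReal :=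
  ∑' k : ℕ, ENNReal.ofReal (szk n ((k + p : ℕ) : ℤ) x) *
    (ENNReal.ofReal n * ∫⁻ t in Set.Ioi (0 : ℝ), ENNReal.ofReal (szk n ((k + q : ℕ) : ℤ) t) * φ t)

lemma measurable_ofReal_szk_natCast (n : ℝ) (k : ℕ) :
    Measurable fun t => ENNReal.ofReal (szk n (k : ℤ) t) :=
  (continuous_szk_natCast n k).measurable.ennreal_ofReal

lemma measurable_durrmeyerLIntegral (n : ℝ) (p q : ℕ) (φ : ℝ → ENNReal) :
    Measurable (durrmeyerLIntegral n p q φ) :=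
  Measurable.tsum fun _ => (measurable_ofReal_szk_natCast _ _).mul_const _

lemma durrmeyerLIntegral_comp {p q : ℕ} (hpq : p = 0 ∨ q = 0) {m n N : ℝ} (hm : 0 < m)
    (hn : 0 < n) (hN : N = m * n / (m + n)) {φ : ℝ → ENNReal}
    (hφ : AEMeasurable φ (volume.restrict (Set.Ioi 0))) {x : ℝ} (hx : 0 ≤ x) :
    durrmeyerLIntegral m p q (durrmeyerLIntegral n p q φ) x = durrmeyerLIntegral N p q φ x := by
  have hN0 : 0 ≤ N := by rw [hN]; positivity
  have hmeas : ∀ (c : ℝ) (k : ℕ), AEMeasurable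
      (fun t => ENNReal.ofReal (szk c (k : ℤ) t) * φ t) (volume.restrict (Set.Ioi 0)) :=
    fun c k => (measurable_ofReal_szk_natCast c k).aemeasurable.mul hφ
  have hR : durrmeyerLIntegral N p q φ x = ∫⁻ t in Set.Ioi (0 : ℝ),
      (∑' r : ℕ, ENNReal.ofReal N * ENNReal.ofReal (szk N ((r + p : ℕ) : ℤ) x)
        * ENNReal.ofReal (szk N ((r + q : ℕ) : ℤ) t)) * φ t := by
    simp_rw [← ENNReal.tsum_mul_right, mul_assoc]
    rw [lintegral_tsum fun r => ((hmeas N (r + q)).const_mul _).const_mul _]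
    refine tsum_congr fun r => ?_
    rw [lintegral_const_mul' _ _ ENNReal.ofReal_ne_top,
      lintegral_const_mul' _ _ ENNReal.ofReal_ne_top]
    ring
  have hinner : ∀ k : ℕ, ∫⁻ u in Set.Ioi (0 : ℝ), ENNReal.ofReal (szk m ((k + q : ℕ) : ℤ) u)
        * durrmeyerLIntegral n p q φ u
      = ∑' i : ℕ, ENNReal.ofReal ((Nat.choose (k + q + (i + p)) (k + q)) * m ^ (k + q)
          * n ^ (i + p) / (m + n) ^ (k + q + (i + p) + 1))
        * (ENNReal.ofReal n
          * ∫⁻ t in Set.Ioi (0 : ℝ), ENNReal.ofReal (szk n ((i + q : ℕ) : ℤ) t) * φ t) := by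
    intro k
    simp_rw [durrmeyerLIntegral, ← ENNReal.tsum_mul_left, ← mul_assoc]
    have hprod : ∀ i : ℕ, Measurable fun u => ENNReal.ofReal (szk m ((k + q : ℕ) : ℤ) u)
        * ENNReal.ofReal (szk n ((i + p : ℕ) : ℤ) u) := fun i =>
      (measurable_ofReal_szk_natCast _ _).mul (measurable_ofReal_szk_natCast _ _)
    rw [lintegral_tsum fun i => (((hprod i).mul_const _).mul_const _).aemeasurable]
    refine tsum_congr fun i => ?_
    rw [lintegral_mul_const _ ((hprod i).mul_const _), lintegral_mul_const _ (hprod i),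
      lintegral_szk_mul_szk hm hn]
  have hentry : ∀ k i : ℕ, ENNReal.ofReal (szk m ((k + p : ℕ) : ℤ) x) * (ENNReal.ofReal m *
      (ENNReal.ofReal ((Nat.choose (k + q + (i + p)) (k + q)) * m ^ (k + q)
          * n ^ (i + p) / (m + n) ^ (k + q + (i + p) + 1))
        * (ENNReal.ofReal n
          * ∫⁻ t in Set.Ioi (0 : ℝ), ENNReal.ofReal (szk n ((i + q : ℕ) : ℤ) t) * φ t)))
      = ∫⁻ t in Set.Ioi (0 : ℝ), ENNReal.ofReal (szk m ((k + p : ℕ) : ℤ) x * m *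
        (n * szk n ((i + q : ℕ) : ℤ) t) *
      ((Nat.choose (k + q + (i + p)) (k + q)) * m ^ (k + q) * n ^ (i + p)
        / (m + n) ^ (k + q + (i + p) + 1))) * φ t := by
    intro k i
    rw [← lintegral_const_mul' _ _ ENNReal.ofReal_ne_top,
      ← lintegral_const_mul' _ _ ENNReal.ofReal_ne_top,
      ← lintegral_const_mul' _ _ ENNReal.ofReal_ne_top,
      ← lintegral_const_mul' _ _ ENNReal.ofReal_ne_top]
    refine setLIntegral_congr_fun measurableSet_Ioi fun t ht => ?_
    have h1 := szk_natCast_nonneg hm.le hx (k + p)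
    have h2 := szk_natCast_nonneg hn.le (le_of_lt ht) (i + q)
    rw [ENNReal.ofReal_mul (by positivity), ENNReal.ofReal_mul (by positivity),
      ENNReal.ofReal_mul (by positivity), ENNReal.ofReal_mul (by positivity)]
    ring
  have hmeas' : ∀ k i : ℕ, AEMeasurable (fun t => ENNReal.ofReal
      (szk m ((k + p : ℕ) : ℤ) x * m * (n * szk n ((i + q : ℕ) : ℤ) t) *
      ((Nat.choose (k + q + (i + p)) (k + q)) * m ^ (k + q) * n ^ (i + p)
        / (m + n) ^ (k + q + (i + p) + 1))) * φ t) (volume.restrict (Set.Ioi 0)) := by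
    intro k i
    refine AEMeasurable.mul (Measurable.aemeasurable ?_) hφ
    have := (continuous_szk_natCast n (i + q)).measurable
    fun_prop
  rw [hR, durrmeyerLIntegral]
  simp_rw [hinner, ← ENNReal.tsum_mul_left, hentry]
  simp_rw [← lintegral_tsum (hmeas' _)]
  rw [← lintegral_tsum fun k => AEMeasurable.tsum (hmeas' k)]
  refine setLIntegral_congr_fun measurableSet_Ioi fun t ht => ?_
  simp only [ENNReal.tsum_mul_right]
  rw [tsum_tsum_szk_kernel hpq hm hn hN hx (le_of_lt ht)]

lemma durrmeyerLIntegral_ne_top {n A K : ℝ} (hA : 0 ≤ A) (hn : A < n) (hK : 0 ≤ K) (p q : ℕ)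
    {φ : ℝ → ENNReal} (hφ : ∀ t > 0, φ t ≤ ENNReal.ofReal (K * Real.exp (A * t)))
    {x : ℝ} (hx : 0 ≤ x) : durrmeyerLIntegral n p q φ x ≠ ⊤ := by
  have hn0 : 0 < n := hA.trans_lt hn
  have hnA : 0 < n - A := by linarith
  set y := n / (n - A) with hy
  have hy0 : 0 < y := by positivity
  have hint : ∀ k : ℕ, ∫⁻ t in Set.Ioi (0 : ℝ), ENNReal.ofReal (szk n (k : ℤ) t) * φ t
      ≤ ENNReal.ofReal (K * y ^ k * (1 / (n - A))) := by
    intro k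
    rw [ENNReal.ofReal_mul (by positivity), ← lintegral_szk hnA,
      ← lintegral_const_mul' _ _ ENNReal.ofReal_ne_top]
    refine setLIntegral_mono' measurableSet_Ioi fun t ht => ?_
    refine (mul_le_mul_right (hφ t ht) _).trans_eq ?_
    rw [← ENNReal.ofReal_mul (szk_natCast_nonneg hn0.le (le_of_lt ht) k),
      ← ENNReal.ofReal_mul (by positivity)]
    congr 1
    rw [szk_natCast, szk_natCast, show -(n - A) * t = -n * t + A * t by ring, Real.exp_add, hy]
    simp only [mul_pow, div_pow]
    field_simp
  have hsum : Summable fun k : ℕ => szk n ((k + p : ℕ) : ℤ) x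
      * (n * (K * y ^ (k + q) * (1 / (n - A)))) := by
    have h1 := (NormedSpace.expSeries_div_hasSum_exp (𝔸 := ℝ) (n * x * y)).summable
    have h2 := ((summable_nat_add_iff p).2 h1).mul_left
      (Real.exp (-n * x) * n * K * y ^ q / y ^ p * (1 / (n - A)))
    refine h2.congr fun k => ?_
    rw [szk_natCast]
    simp only [mul_pow, pow_add]
    field_simp
  refine ne_top_of_le_ne_top hsum.tsum_ofReal_ne_top (ENNReal.tsum_le_tsum fun k => ?_)
  rw [ENNReal.ofReal_mul (szk_natCast_nonneg hn0.le hx _), ENNReal.ofReal_mul hn0.le]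
  gcongr
  exact hint _

lemma integrable_szk_mul_toReal {n : ℝ} (hn : 0 ≤ n) (k : ℕ) {W : ℝ → ENNReal}
    (hW : AEMeasurable W (volume.restrict (Set.Ioi 0)))
    (hfin : ∫⁻ t in Set.Ioi (0 : ℝ), ENNReal.ofReal (szk n (k : ℤ) t) * W t ≠ ⊤) :
    IntegrableOn (fun t => szk n (k : ℤ) t * (W t).toReal) (Set.Ioi 0) ∧
    ∫ t in Set.Ioi (0 : ℝ), szk n (k : ℤ) t * (W t).toReal
      = (∫⁻ t in Set.Ioi (0 : ℝ), ENNReal.ofReal (szk n (k : ℤ) t) * W t).toReal := by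
  have hm : AEMeasurable (fun t => ENNReal.ofReal (szk n (k : ℤ) t) * W t)
      (volume.restrict (Set.Ioi 0)) := (measurable_ofReal_szk_natCast n k).aemeasurable.mul hW
  have heq : (fun t => (ENNReal.ofReal (szk n (k : ℤ) t) * W t).toReal)
      =ᵐ[volume.restrict (Set.Ioi 0)] fun t => szk n (k : ℤ) t * (W t).toReal := by
    filter_upwards [ae_restrict_mem measurableSet_Ioi] with t ht
    rw [ENNReal.toReal_mul, ENNReal.toReal_ofReal (szk_natCast_nonneg hn (le_of_lt ht) k)]
  refine ⟨(integrable_toReal_of_lintegral_ne_top hm hfin).congr heq, ?_⟩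
  rw [← integral_congr_ae heq, integral_toReal hm (ae_lt_top' hm hfin)]

lemma durrmeyerLIntegral_moment_ne_top {n : ℝ} (hn : 0 < n) {p q : ℕ} {W : ℝ → ENNReal}
    (hfin : durrmeyerLIntegral n p q W 1 ≠ ⊤) (k : ℕ) :
    ∫⁻ t in Set.Ioi (0 : ℝ), ENNReal.ofReal (szk n ((k + q : ℕ) : ℤ) t) * W t ≠ ⊤ := by
  intro htop
  refine ENNReal.ne_top_of_tsum_ne_top hfin k ?_
  have h1 : 0 < szk n ((k + p : ℕ) : ℤ) 1 := by rw [szk_natCast]; positivity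
  rw [htop, ENNReal.mul_top (by simpa using hn), ENNReal.mul_top (by simpa using h1)]

lemma hasSum_durrmeyerLIntegral_toReal {n : ℝ} (hn : 0 ≤ n) {p q : ℕ} {W : ℝ → ENNReal} {x : ℝ}
    (hx : 0 ≤ x) (hfin : durrmeyerLIntegral n p q W x ≠ ⊤) :
    HasSum (fun k : ℕ => szk n ((k + p : ℕ) : ℤ) x * (n *
      (∫⁻ t in Set.Ioi (0 : ℝ), ENNReal.ofReal (szk n ((k + q : ℕ) : ℤ) t) * W t).toReal))
      (durrmeyerLIntegral n p q W x).toReal := by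
  have h := ENNReal.hasSum_toReal hfin
  rw [← ENNReal.tsum_toReal_eq (ENNReal.ne_top_of_tsum_ne_top hfin)] at h
  simpa only [durrmeyerLIntegral, ENNReal.toReal_mul, ENNReal.toReal_ofReal hn,
    ENNReal.toReal_ofReal (szk_natCast_nonneg hn hx _)] using h

lemma integrableOn_szk {n : ℝ} (hn : 0 < n) (k : ℕ) :
    IntegrableOn (szk n (k : ℤ)) (Set.Ioi 0) ∧
      ∫ t in Set.Ioi (0 : ℝ), szk n (k : ℤ) t = 1 / n := by
  have h := integrable_szk_mul_toReal hn.le k (W := fun _ => 1) aemeasurable_const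
    (by simp [lintegral_szk hn])
  simpa [lintegral_szk hn, hn.le] using h

lemma Snj_eq_add_toReal_sub_toReal {n : ℝ} (hn : 0 < n) {j : ℤ} {h : ℝ → ℝ} {a : ℝ}
    (h0 : 0 < j → h 0 = a) {U V : ℝ → ENNReal}
    (hU : AEMeasurable U (volume.restrict (Set.Ioi 0)))
    (hV : AEMeasurable V (volume.restrict (Set.Ioi 0)))
    (hh : ∀ t > 0, h t = a + (U t).toReal - (V t).toReal)
    (hLU : ∀ x ≥ 0, durrmeyerLIntegral n j.toNat (-j).toNat U x ≠ ⊤)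
    (hLV : ∀ x ≥ 0, durrmeyerLIntegral n j.toNat (-j).toNat V x ≠ ⊤) {x : ℝ} (hx : 0 ≤ x) :
    Snj n j h x = a + (durrmeyerLIntegral n j.toNat (-j).toNat U x).toReal
      - (durrmeyerLIntegral n j.toNat (-j).toNat V x).toReal := by
  set p := j.toNat with hp
  set q := (-j).toNat with hq
  have hint : ∀ k : ℕ, ∫ t in Set.Ioi (0 : ℝ), szk n ((k + q : ℕ) : ℤ) t * h t
      = a * (1 / n)
        + (∫⁻ t in Set.Ioi (0 : ℝ), ENNReal.ofReal (szk n ((k + q : ℕ) : ℤ) t) * U t).toReal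
        - (∫⁻ t in Set.Ioi (0 : ℝ), ENNReal.ofReal (szk n ((k + q : ℕ) : ℤ) t) * V t).toReal := by
    intro k
    obtain ⟨hiU, heU⟩ := integrable_szk_mul_toReal hn.le (k + q) hU
      (durrmeyerLIntegral_moment_ne_top hn (hLU 1 zero_le_one) k)
    obtain ⟨hiV, heV⟩ := integrable_szk_mul_toReal hn.le (k + q) hV
      (durrmeyerLIntegral_moment_ne_top hn (hLV 1 zero_le_one) k)
    obtain ⟨hi1, he1⟩ := integrableOn_szk hn (k + q)
    have hiaU : IntegrableOn (fun t => a * szk n ((k + q : ℕ) : ℤ) t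
        + szk n ((k + q : ℕ) : ℤ) t * (U t).toReal) (Set.Ioi 0) := (hi1.const_mul a).add hiU
    rw [← heU, ← heV, ← he1, ← integral_const_mul, ← integral_add (hi1.const_mul a) hiU,
      ← integral_sub hiaU hiV]
    refine setIntegral_congr_fun measurableSet_Ioi fun t ht => ?_
    simp only [hh t ht]
    ring
  have hs1 : HasSum (fun k : ℕ => szk n ((k + p : ℕ) : ℤ) x * a)
      ((1 - ∑ k ∈ Finset.range p, szk n (k : ℤ) x) * a) :=
    ((hasSum_nat_add_iff' p).2 (hasSum_szk_natCast n x)).mul_right a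
  have hs := (hs1.add (hasSum_durrmeyerLIntegral_toReal hn.le hx (hLU x hx))).sub
    (hasSum_durrmeyerLIntegral_toReal hn.le hx (hLV x hx))
  have hterm : ∀ k : ℕ, szk n (max 0 j + k) x *
        (n * ∫ t in Set.Ioi (0:ℝ), szk n (max 0 j + k - j) t * h t)
      = szk n ((k + p : ℕ) : ℤ) x * (n * ∫ t in Set.Ioi (0:ℝ), szk n ((k + q : ℕ) : ℤ) t * h t) := by
    intro k
    rw [show max 0 j + (k : ℤ) = ((k + p : ℕ) : ℤ) by omega,
      show ((k + p : ℕ) : ℤ) - j = ((k + q : ℕ) : ℤ) by omega]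
  have hzero : h 0 * ∑ k ∈ Finset.range p, szk n (k : ℤ) x
      = a * ∑ k ∈ Finset.range p, szk n (k : ℤ) x := by
    rcases lt_or_ge 0 j with hj | hj
    · rw [h0 hj]
    · rw [show p = 0 by omega]; simp
  have htsum : ∑' k : ℕ, szk n (max 0 j + k) x *
        (n * ∫ t in Set.Ioi (0:ℝ), szk n (max 0 j + k - j) t * h t)
      = (1 - ∑ k ∈ Finset.range p, szk n (k : ℤ) x) * a
        + (durrmeyerLIntegral n p q U x).toReal - (durrmeyerLIntegral n p q V x).toReal := by
    rw [← hs.tsum_eq]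
    refine tsum_congr fun k => ?_
    rw [hterm, hint]
    field_simp
  rw [Snj, hzero, htsum]
  ring

lemma durrmeyerLIntegral_zero_right (n : ℝ) {p : ℕ} (hp : 0 < p) (q : ℕ) (φ : ℝ → ENNReal) :
    durrmeyerLIntegral n p q φ 0 = 0 := by
  have h : ∀ k : ℕ, szk n ((k + p : ℕ) : ℤ) 0 = 0 := fun k => by
    rw [szk_natCast, mul_zero, zero_pow (by omega), zero_div, zero_mul]
  simp only [durrmeyerLIntegral, h, ENNReal.ofReal_zero, zero_mul, tsum_zero]

/-- Iterates: `S_{m,j}^l f = S_{m/l,j} f` on `[0,∞)` for `m > l A`. -/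
theorem iterate_Snj (j : ℤ) (A : ℝ) (hA : 0 ≤ A) (f : ℝ → ℝ) (hf : MemEA A f)
    (l : ℕ) (hl : 1 ≤ l) (m : ℝ) (hm : m > l * A) :
    ∀ x ≥ (0:ℝ), (Snj m j)^[l] f x = Snj (m / l) j f x := by
  obtain ⟨hloc, K, hK, hbound⟩ := hf
  have hfm : AEMeasurable f (volume.restrict (Set.Ioi 0)) :=
    hloc.aestronglyMeasurable.aemeasurable.mono_measure
      (Measure.restrict_mono Set.Ioi_subset_Ici_self le_rfl)
  set U : ℝ → ENNReal := fun t => ENNReal.ofReal (f t - f 0) with hUdef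
  set V : ℝ → ENNReal := fun t => ENNReal.ofReal (-(f t - f 0)) with hVdef
  have hU : AEMeasurable U (volume.restrict (Set.Ioi 0)) := (hfm.sub_const _).ennreal_ofReal
  have hV : AEMeasurable V (volume.restrict (Set.Ioi 0)) := (hfm.sub_const _).neg.ennreal_ofReal
  have hUV : ∀ t > 0, f t = f 0 + (U t).toReal - (V t).toReal := by
    intro t _
    simp only [hUdef, hVdef, ENNReal.toReal_ofReal']
    rw [add_sub_assoc, max_zero_sub_max_neg_zero_eq_self]
    ring
  have hdiff : ∀ t > 0, |f t - f 0| ≤ (K + |f 0|) * Real.exp (A * t) := by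
    intro t ht
    have h1 : 1 ≤ Real.exp (A * t) := Real.one_le_exp (by positivity)
    have h2 := abs_sub (f t) (f 0)
    nlinarith [hbound t ht.le, abs_nonneg (f 0)]
  have hfinU : ∀ n > A, ∀ x ≥ 0, durrmeyerLIntegral n j.toNat (-j).toNat U x ≠ ⊤ :=
    fun n hn x hx => durrmeyerLIntegral_ne_top hA hn (by positivity) _ _
      (fun t ht => ENNReal.ofReal_le_ofReal ((le_abs_self _).trans (hdiff t ht))) hx
  have hfinV : ∀ n > A, ∀ x ≥ 0, durrmeyerLIntegral n j.toNat (-j).toNat V x ≠ ⊤ :=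
    fun n hn x hx => durrmeyerLIntegral_ne_top hA hn (by positivity) _ _
      (fun t ht => ENNReal.ofReal_le_ofReal ((neg_le_abs _).trans (hdiff t ht))) hx
  have hdiv : ∀ l : ℕ, 1 ≤ l → m > l * A → m / l > A := by
    intro l hl hm
    have : (0 : ℝ) < l := by exact_mod_cast hl
    rw [gt_iff_lt, lt_div_iff₀ this]
    linarith
  have hsingle : ∀ n > A, ∀ x ≥ 0, Snj n j f x
      = f 0 + (durrmeyerLIntegral n j.toNat (-j).toNat U x).toReal
        - (durrmeyerLIntegral n j.toNat (-j).toNat V x).toReal :=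
    fun n hn x hx => Snj_eq_add_toReal_sub_toReal (hA.trans_lt hn) (fun _ => rfl) hU hV hUV
      (hfinU n hn) (hfinV n hn) hx
  have hpq : j.toNat = 0 ∨ (-j).toNat = 0 := by omega
  suffices hiter : ∀ x ≥ (0 : ℝ), (Snj m j)^[l] f x
      = f 0 + (durrmeyerLIntegral (m / l) j.toNat (-j).toNat U x).toReal
        - (durrmeyerLIntegral (m / l) j.toNat (-j).toNat V x).toReal by
    intro x hx
    rw [hiter x hx, hsingle _ (hdiv l hl hm) x hx]
  induction l, hl using Nat.le_induction with
  | base =>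
    intro x hx
    simpa using hsingle m (by simpa using hm) x hx
  | succ l hl ih =>
    push_cast at hm
    have hml : m > l * A := by nlinarith
    have hl0 : (0 : ℝ) < l := by exact_mod_cast hl
    have hn := hdiv l hl hml
    have hn0 : 0 < m / l := hA.trans_lt hn
    have hm0 : 0 < m := by
      have : 0 ≤ l * A := by positivity
      linarith
    have hN : m / ((l + 1 : ℕ) : ℝ) = m * (m / l) / (m + m / l) := by
      push_cast
      field_simp
    have hcomp : ∀ {W : ℝ → ENNReal}, AEMeasurable W (volume.restrict (Set.Ioi 0)) → ∀ x ≥ 0,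
        durrmeyerLIntegral m j.toNat (-j).toNat
          (durrmeyerLIntegral (m / l) j.toNat (-j).toNat W) x
        = durrmeyerLIntegral (m / ((l + 1 : ℕ) : ℝ)) j.toNat (-j).toNat W x :=
      fun hW x hx => durrmeyerLIntegral_comp hpq hm0 hn0 hN hW hx
    have hN' := hdiv (l + 1) (by omega) (by push_cast; exact hm)
    intro x hx
    rw [Function.iterate_succ_apply', ← hcomp hU x hx, ← hcomp hV x hx]
    refine Snj_eq_add_toReal_sub_toReal hm0 (fun hj => ?_)
      (measurable_durrmeyerLIntegral _ _ _ _).aemeasurable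
      (measurable_durrmeyerLIntegral _ _ _ _).aemeasurable (fun t ht => ih hml t ht.le)
      (fun y hy => ?_) (fun y hy => ?_) hx
    · have hp : 0 < j.toNat := by omega
      rw [ih hml 0 le_rfl, durrmeyerLIntegral_zero_right _ hp, durrmeyerLIntegral_zero_right _ hp]
      simp
    · rw [hcomp hU y hy]; exact hfinU _ hN' y hy
    · rw [hcomp hV y hy]; exact hfinV _ hN' y hy
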